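/- arXiv:2504.14599 — 2 statements merged into one kernel-verified Lean document; each statement's English description precedes it below -/
import Mathlib

section
/- Let N be a positive integer, let a be an integer with 1 ≤ a ≤ N, and let r be a real number. Then there exists ε > 0 such that for all real u, v with |u|, |v| < ε, one has Σ_{k ≥ n+1, n ≥ 1} t^r_{N,a}(k−n+1, {1}^{n−1}) u^{k−n−1} v^{n−1} = (1/((a−u)(a−vr))) · ₃F₂((a−u)/N, (a+v(1−r))/N, 1; (a+N−u)/N, (a+N−vr)/N; 1), where {1}^{n−1} denotes 1 repeated n−1 times and the left-hand side converges absolutely. -/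
/-- All groupings of an index obtained by replacing each box in
`k₁ □ k₂ □ ⋯ □ kₙ` by a comma (new block) or a plus (merge). -/
def groupings : List ℕ → List (List ℕ)
  | [] => [[]]
  | [x] => [[x]]
  | x :: y :: rest => ((groupings (y :: rest)).map (x :: ·)) ++ groupings ((x + y) :: rest)
termination_by l => l.length

/-- Multiple t-value of level `N` with residue `a`:
`t_{N,a}(k) = Σ_{m₁ > ⋯ > mₙ > 0, mᵢ ≡ a (mod N)} 1/(m₁^{k₁} ⋯ mₙ^{kₙ})`. -/
noncomputable def tv (N a : ℕ) (k : List ℕ) : ℝ :=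
  ∑' m : {f : Fin k.length → ℕ // StrictAnti f ∧ ∀ i, 0 < f i ∧ f i % N = a % N},
    ∏ i : Fin k.length, ((m.1 i : ℝ) ^ k.get i)⁻¹

/-- Interpolated multiple t-value of level `N`:
`t^r_{N,a}(k) = Σ_p r^{n - dep(p)} t_{N,a}(p)` over all groupings `p` of `k`. -/
noncomputable def itv (N a : ℕ) (r : ℝ) (k : List ℕ) : ℝ :=
  ((groupings k).map (fun p => r ^ (k.length - p.length) * tv N a p)).sum

/-- Rising factorial (Pochhammer symbol) `(b)ₙ = b(b+1)⋯(b+n-1)`. -/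
noncomputable def poch {K : Type*} [RCLike K] (b : K) (n : ℕ) : K :=
  ∏ i ∈ Finset.range n, (b + i)

/-- The generalized hypergeometric function
`F(b; c; z) = Σ_{n≥0} (b₁)ₙ⋯(bₚ)ₙ/((c₁)ₙ⋯(c_q)ₙ) · zⁿ/n!`. -/
noncomputable def genHyp {K : Type*} [RCLike K] (b c : List K) (z : K) : K :=
  ∑' n : ℕ, ((b.map fun x => poch x n).prod / (c.map fun x => poch x n).prod)
    * z ^ n / (n.factorial : K)

/-- Strictly decreasing sequences of length `n` with values in `T`. -/
abbrev DecSeq (T : Set ℕ) (n : ℕ) : Type :=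
  {f : Fin n → ℕ // StrictAnti f ∧ ∀ i, f i ∈ T}

/-- A nonempty decreasing sequence in a lower set is its head together with its tail. -/
def decSeqConsEquiv (T : Set ℕ) (hT : IsLowerSet T) (n : ℕ) :
    DecSeq T (n + 1) ≃ Σ j : T, DecSeq (Finset.range (j : ℕ) : Set ℕ) n where
  toFun f := ⟨⟨f.1 0, f.2.2 0⟩, Fin.tail f.1,
    fun i j hij => f.2.1 (Fin.succ_lt_succ_iff.2 hij),
    fun i => Finset.mem_coe.2 (Finset.mem_range.2 (f.2.1 (Fin.succ_pos i)))⟩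
  invFun s := ⟨Fin.cons s.1.1 s.2.1, by
    constructor
    · intro i j hij
      induction i using Fin.cases with
      | zero =>
        induction j using Fin.cases with
        | zero => exact absurd hij (lt_irrefl _)
        | succ j => simpa using s.2.2.2 j
      | succ i =>
        induction j using Fin.cases with
        | zero => exact absurd hij (Fin.not_lt_zero _)
        | succ j => simpa using s.2.2.1 (Fin.succ_lt_succ_iff.1 hij)
    · intro i
      induction i using Fin.cases with
      | zero => exact s.1.2
      | succ i => exact hT (le_of_lt (by simpa using s.2.2.2 i)) s.1.2⟩
  left_inv f := by
    apply Subtype.ext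
    exact Fin.cons_self_tail f.1
  right_inv s := rfl

/-- The sum of `∏ m(fᵢ)^{-kᵢ}` over strictly decreasing sequences `f` in `T`. -/
noncomputable def decSum (m : ℕ → ℝ) (k : List ℕ) (T : Set ℕ) : ℝ :=
  ∑' f : DecSeq T k.length, ∏ i : Fin k.length, (m (f.1 i) ^ k.get i)⁻¹

instance finite_decSeq (J n : ℕ) : Finite (DecSeq (Finset.range J : Set ℕ) n) := by
  let φ : DecSeq (Finset.range J : Set ℕ) n → (Fin n → (Finset.range J : Set ℕ)) :=
    fun f i => ⟨f.1 i, f.2.2 i⟩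
  refine Finite.of_injective φ fun f g h => Subtype.ext (funext fun i => ?_)
  exact congrArg Subtype.val (congrFun h i)

theorem decSum_cons (m : ℕ → ℝ) (hm : ∀ j, 0 ≤ m j) (x : ℕ) (k : List ℕ) (T : Set ℕ)
    (hT : IsLowerSet T) :
    decSum m (x :: k) T
      = ∑' j : T, (m j ^ x)⁻¹ * decSum m k (Finset.range (j : ℕ) : Set ℕ) := by
  let F : (Σ j : T, DecSeq (Finset.range (j : ℕ) : Set ℕ) k.length) → ℝ :=
    fun s => (m s.1 ^ x)⁻¹ * ∏ i : Fin k.length, (m (s.2.1 i) ^ k.get i)⁻¹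
  have hF : decSum m (x :: k) T = ∑' s, F s := by
    rw [← (decSeqConsEquiv T hT k.length).tsum_eq F]
    refine tsum_congr fun f => ?_
    exact Fin.prod_univ_succ (fun i : Fin (k.length + 1) => (m (f.1 i) ^ (x :: k).get i)⁻¹)
  have hF0 : ∀ s, 0 ≤ F s := fun s =>
    mul_nonneg (inv_nonneg.2 (pow_nonneg (hm _) _))
      (Finset.prod_nonneg fun i _ => inv_nonneg.2 (pow_nonneg (hm _) _))
  have hfib : ∀ j : T, Summable fun g => F ⟨j, g⟩ := fun j => Summable.of_finite
  have hinner : ∀ j : T, ∑' g, F ⟨j, g⟩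
      = (m j ^ x)⁻¹ * decSum m k (Finset.range (j : ℕ) : Set ℕ) := fun j => by
    simp only [F, decSum]
    rw [tsum_mul_left]
  rw [hF]
  by_cases hs : Summable F
  · rw [hs.tsum_sigma' hfib]
    exact tsum_congr hinner
  · rw [tsum_eq_zero_of_not_summable hs, tsum_eq_zero_of_not_summable]
    intro h
    exact hs ((summable_sigma_of_nonneg hF0).2 ⟨hfib, by simpa only [hinner] using h⟩)

/-- The truncated sum `∑_{J > j₁ > ⋯ > jₙ} ∏ m(jᵢ)^{-kᵢ}`. -/
noncomputable def truncSum (m : ℕ → ℝ) : List ℕ → ℕ → ℝ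
  | [], _ => 1
  | x :: k, J => ∑ j ∈ Finset.range J, (m j ^ x)⁻¹ * truncSum m k j

theorem truncSum_nonneg (m : ℕ → ℝ) (hm : ∀ j, 0 ≤ m j) (k : List ℕ) (J : ℕ) :
    0 ≤ truncSum m k J := by
  induction k generalizing J with
  | nil => exact zero_le_one
  | cons x k ih =>
    exact Finset.sum_nonneg fun j _ => mul_nonneg (inv_nonneg.2 (pow_nonneg (hm _) _)) (ih j)

theorem decSum_range (m : ℕ → ℝ) (hm : ∀ j, 0 ≤ m j) (k : List ℕ) (J : ℕ) :
    decSum m k (Finset.range J : Set ℕ) = truncSum m k J := by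
  induction k generalizing J with
  | nil =>
    have : Unique (DecSeq (Finset.range J : Set ℕ) ([] : List ℕ).length) :=
      { default := ⟨fun i => i.elim0, fun i => i.elim0, fun i => i.elim0⟩
        uniq := fun f => Subtype.ext (funext fun i => i.elim0) }
    rw [decSum, tsum_fintype]
    simp [truncSum]
  | cons x k ih =>
    rw [decSum_cons m hm x k _ (by
      rw [Finset.coe_range]; exact isLowerSet_Iio J)]
    simp only [ih]
    exact Finset.tsum_subtype' (Finset.range J) (fun j => (m j ^ x)⁻¹ * truncSum m k j)

theorem decSum_cons_univ (m : ℕ → ℝ) (hm : ∀ j, 0 ≤ m j) (x : ℕ) (k : List ℕ) :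
    decSum m (x :: k) Set.univ = ∑' j, (m j ^ x)⁻¹ * truncSum m k j := by
  rw [decSum_cons m hm x k _ isLowerSet_univ]
  simp only [decSum_range m hm]
  exact tsum_univ (fun j => (m j ^ x)⁻¹ * truncSum m k j)

theorem le_of_mod_eq {N a b : ℕ} (ha : a ≤ N) (hb : 0 < b) (h : b % N = a % N) : a ≤ b := by
  rcases ha.lt_or_eq with hlt | rfl
  · rw [Nat.mod_eq_of_lt hlt] at h
    exact h ▸ Nat.mod_le _ _
  · rw [Nat.mod_self] at h
    exact Nat.le_of_dvd hb (Nat.dvd_of_mod_eq_zero h)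

theorem tv_eq_decSum (N a : ℕ) (ha1 : 1 ≤ a) (ha2 : a ≤ N) (k : List ℕ) :
    tv N a k = decSum (fun j => (a : ℝ) + j * N) k Set.univ := by
  have hN : 0 < N := by omega
  have hmono : StrictMono fun j : ℕ => a + j * N := fun i j hij =>
    Nat.add_lt_add_left (Nat.mul_lt_mul_of_pos_right hij hN) a
  let φ : DecSeq Set.univ k.length →
      {f : Fin k.length → ℕ // StrictAnti f ∧ ∀ i, 0 < f i ∧ f i % N = a % N} :=
    fun f => ⟨fun i => a + f.1 i * N, fun i j hij => hmono (f.2.1 hij),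
      fun i => ⟨Nat.add_pos_left ha1 _, by simp⟩⟩
  have hφ : Function.Bijective φ := by
    constructor
    · intro f g h
      refine Subtype.ext (funext fun i => hmono.injective ?_)
      exact congrFun (congrArg Subtype.val h) i
    · intro f
      have hex : ∀ i, ∃ j, a + j * N = f.1 i := by
        intro i
        obtain ⟨h0, h1⟩ := f.2.2 i
        have hle : a ≤ f.1 i := le_of_mod_eq ha2 h0 h1
        obtain ⟨c, hc⟩ := (Nat.modEq_iff_dvd' hle).1 (show a ≡ f.1 i [MOD N] from h1.symm)
        exact ⟨c, by rw [mul_comm, ← hc]; omega⟩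
      choose g hg using hex
      refine ⟨⟨g, fun i j hij => ?_, fun i => Set.mem_univ _⟩, Subtype.ext (funext hg)⟩
      have := f.2.1 hij
      rw [← hg i, ← hg j] at this
      exact hmono.lt_iff_lt.1 this
  rw [tv, decSum, ← (Equiv.ofBijective φ hφ).tsum_eq]
  refine tsum_congr fun f => ?_
  simp [φ]

theorem length_le_of_mem_groupings (k : List ℕ) : ∀ p ∈ groupings k, p.length ≤ k.length := by
  induction k using groupings.induct with
  | case1 => simp [groupings]
  | case2 x => simp [groupings]
  | case3 x y k ih₁ ih₂ =>
    intro p hp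
    rw [groupings, List.mem_append, List.mem_map] at hp
    rcases hp with ⟨q, hq, rfl⟩ | hp
    · simpa using ih₁ q hq
    · exact (ih₂ p hp).trans (by simp)

/-- The weighted sum `∑_p r^{n - dep(p)} G(p)` over the groupings `p` of `k`. -/
noncomputable def groupSum (G : List ℕ → ℝ) (r : ℝ) (k : List ℕ) : ℝ :=
  ((groupings k).map (fun p => r ^ (k.length - p.length) * G p)).sum

theorem groupSum_cons_cons (G : List ℕ → ℝ) (r : ℝ) (x y : ℕ) (k : List ℕ) :
    groupSum G r (x :: y :: k)
      = groupSum (fun p => G (x :: p)) r (y :: k) + r * groupSum G r ((x + y) :: k) := by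
  rw [groupSum, groupings, List.map_append, List.sum_append, List.map_map]
  congr 1
  · simp [groupSum, Function.comp_def]
  · rw [groupSum, ← List.sum_map_mul_left]
    congr 1
    refine List.map_congr_left fun p hp => ?_
    have := length_le_of_mem_groupings _ p hp
    simp only [List.length_cons] at this ⊢
    rw [← mul_assoc, ← pow_succ']
    congr 2
    omega

theorem List.hasSum_map_sum {ι κ : Type*} (L : List κ) (f : κ → ι → ℝ) (g : κ → ℝ)
    (h : ∀ p ∈ L, HasSum (f p) (g p)) :
    HasSum (fun j => (L.map fun p => f p j).sum) (L.map g).sum := by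
  induction L with
  | nil => simp
  | cons p L ih =>
    simpa using (h p (by simp)).add (ih fun q hq => h q (by simp [hq]))

theorem List.abs_map_sum_le {κ : Type*} (L : List κ) (f : κ → ℝ) :
    |(L.map f).sum| ≤ (L.map fun p => |f p|).sum := by
  induction L with
  | nil => simp
  | cons p L ih => simpa using (abs_add_le _ _).trans (by gcongr)

theorem hasSum_groupSum {ι : Type*} (F : List ℕ → ι → ℝ) (G : List ℕ → ℝ) (r : ℝ) (k : List ℕ)
    (h : ∀ p ∈ groupings k, HasSum (F p) (G p)) :
    HasSum (fun j => groupSum (fun p => F p j) r k) (groupSum G r k) :=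
  List.hasSum_map_sum _ _ _ fun p hp => (h p hp).mul_left _

theorem groupSum_const_mul (c : ℝ) (G : List ℕ → ℝ) (r : ℝ) (k : List ℕ) :
    groupSum (fun p => c * G p) r k = c * groupSum G r k := by
  rw [groupSum, groupSum, ← List.sum_map_mul_left]
  simp only [mul_left_comm]

/-- The truncated interpolated sum of the index `{1}^d`. -/
noncomputable def onesSum (m : ℕ → ℝ) (r : ℝ) (d J : ℕ) : ℝ :=
  groupSum (fun p => truncSum m p J) r (List.replicate d 1)

/-- The coefficient of `m(j)^{-x}` in the interpolated sum of the index `(x, {1}^d)`. -/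
noncomputable def headCoeff (m : ℕ → ℝ) (r : ℝ) (d j : ℕ) : ℝ :=
  ∑ q ∈ Finset.HasAntidiagonal.antidiagonal d, (r / m j) ^ q.1 * onesSum m r q.2 j

theorem onesSum_zero (m : ℕ → ℝ) (r : ℝ) (J : ℕ) : onesSum m r 0 J = 1 := by
  simp [onesSum, groupSum, groupings, truncSum]

theorem headCoeff_zero (m : ℕ → ℝ) (r : ℝ) (j : ℕ) : headCoeff m r 0 j = 1 := by
  simp [headCoeff, onesSum_zero]

theorem headCoeff_succ (m : ℕ → ℝ) (r : ℝ) (d j : ℕ) :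
    headCoeff m r (d + 1) j = onesSum m r (d + 1) j + r / m j * headCoeff m r d j := by
  rw [headCoeff, Finset.Nat.sum_antidiagonal_succ, headCoeff, Finset.mul_sum]
  simp only [pow_zero, one_mul, pow_succ']
  congr 1
  exact Finset.sum_congr rfl fun q _ => by ring

theorem groupSum_finset_sum {ι : Type*} (s : Finset ι) (F : List ℕ → ι → ℝ) (r : ℝ)
    (k : List ℕ) :
    groupSum (fun p => ∑ j ∈ s, F p j) r k = ∑ j ∈ s, groupSum (fun p => F p j) r k := by
  simp only [groupSum]
  generalize groupings k = L
  induction L with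
  | nil => simp
  | cons p L ih =>
    simp only [List.map_cons, List.sum_cons]
    rw [ih, Finset.mul_sum, Finset.sum_add_distrib]

theorem groupSum_truncSum_cons_replicate (m : ℕ → ℝ) (r : ℝ) (d x J : ℕ) :
    groupSum (fun p => truncSum m p J) r (x :: List.replicate d 1)
      = ∑ j ∈ Finset.range J, (m j ^ x)⁻¹ * headCoeff m r d j := by
  induction d generalizing x with
  | zero => simp [groupSum, groupings, truncSum, headCoeff_zero]
  | succ d ih =>
    rw [List.replicate_succ, groupSum_cons_cons, ih, Finset.mul_sum]
    simp only [truncSum]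
    rw [groupSum_finset_sum, ← Finset.sum_add_distrib]
    refine Finset.sum_congr rfl fun j _ => ?_
    rw [groupSum_const_mul, headCoeff_succ, ← List.replicate_succ, ← onesSum, pow_succ, mul_inv]
    ring

theorem onesSum_succ (m : ℕ → ℝ) (r : ℝ) (d J : ℕ) :
    onesSum m r (d + 1) J = ∑ j ∈ Finset.range J, (m j)⁻¹ * headCoeff m r d j := by
  rw [onesSum, List.replicate_succ, groupSum_truncSum_cons_replicate]
  simp only [pow_one]

theorem hasSum_groupSum_decSum (m : ℕ → ℝ) (hm : ∀ j, 1 ≤ m j) (r : ℝ)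
    (hs : ∀ d, ∀ p ∈ groupings (List.replicate d 1),
      Summable fun j => (m j ^ 2)⁻¹ * truncSum m p j)
    (d x : ℕ) (hx : 2 ≤ x) :
    HasSum (fun j => (m j ^ x)⁻¹ * headCoeff m r d j)
      (groupSum (fun p => decSum m p Set.univ) r (x :: List.replicate d 1)) := by
  have hm0 : ∀ j, 0 ≤ m j := fun j => zero_le_one.trans (hm j)
  have key : ∀ d, ∀ x, 2 ≤ x → ∀ p ∈ groupings (List.replicate d 1),
      HasSum (fun j => (m j ^ x)⁻¹ * truncSum m p j) (decSum m (x :: p) Set.univ) := by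
    intro d x hx p hp
    rw [decSum_cons_univ m hm0]
    refine (Summable.of_nonneg_of_le
      (fun j => mul_nonneg (inv_nonneg.2 (pow_nonneg (hm0 j) _)) (truncSum_nonneg m hm0 p j))
      (fun j => ?_) (hs d p hp)).hasSum
    have h1 := hm j
    have h2 : 0 < m j ^ 2 := pow_pos (by linarith) 2
    exact mul_le_mul_of_nonneg_right (inv_anti₀ h2 (pow_le_pow_right₀ h1 hx))
      (truncSum_nonneg m hm0 p j)
  induction d generalizing x with
  | zero =>
    have h := key 0 x hx [] (by simp [groupings])
    simpa [groupSum, groupings, truncSum, headCoeff_zero] using h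
  | succ d ih =>
    rw [List.replicate_succ, groupSum_cons_cons]
    have h1 := hasSum_groupSum (fun p j => (m j ^ x)⁻¹ * truncSum m p j) _ r _ (key (d + 1) x hx)
    have h2 := (ih (x + 1) (by omega)).mul_left r
    convert h1.add h2 using 1
    · funext j
      rw [groupSum_const_mul, headCoeff_succ, ← onesSum, pow_succ, mul_inv]
      ring
    · rfl

theorem abs_onesSum_le (m : ℕ → ℝ) (hm : ∀ j, 0 ≤ m j) (r : ℝ) (d J : ℕ) :
    |onesSum m r d J| ≤ onesSum m |r| d J := by
  refine (List.abs_map_sum_le _ _).trans_eq ?_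
  simp only [onesSum, groupSum, abs_mul, abs_pow, abs_of_nonneg (truncSum_nonneg m hm _ J)]

theorem abs_headCoeff_le (m : ℕ → ℝ) (hm : ∀ j, 0 ≤ m j) (r : ℝ) (d j : ℕ) :
    |headCoeff m r d j| ≤ headCoeff m |r| d j := by
  refine (Finset.abs_sum_le_sum_abs _ _).trans (Finset.sum_le_sum fun q _ => ?_)
  rw [abs_mul, abs_pow, abs_div, abs_of_nonneg (hm j)]
  exact mul_le_mul_of_nonneg_left (abs_onesSum_le m hm r _ _)
    (pow_nonneg (div_nonneg (abs_nonneg r) (hm j)) _)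

theorem truncSum_le_onesSum_one (m : ℕ → ℝ) (hm : ∀ j, 0 ≤ m j) (d J : ℕ) (p : List ℕ)
    (hp : p ∈ groupings (List.replicate d 1)) : truncSum m p J ≤ onesSum m 1 d J := by
  simp only [onesSum, groupSum, one_pow, one_mul]
  refine List.single_le_sum (fun x hx => ?_) _ (List.mem_map_of_mem hp)
  obtain ⟨q, _, rfl⟩ := List.mem_map.1 hx
  exact truncSum_nonneg m hm q J

/-- The partial product `∏_{i<J} (m(i) + v(1 - r)) / (m(i) - rv)`. -/
noncomputable def ratioProd (m : ℕ → ℝ) (r v : ℝ) (J : ℕ) : ℝ :=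
  ∏ i ∈ Finset.range J, (m i + v * (1 - r)) / (m i - r * v)

theorem ratioProd_succ (m : ℕ → ℝ) (r v : ℝ) (J : ℕ) :
    ratioProd m r v (J + 1) = ratioProd m r v J * ((m J + v * (1 - r)) / (m J - r * v)) :=
  Finset.prod_range_succ _ _

theorem headCoeff_mul_pow (m : ℕ → ℝ) (r v : ℝ) (d j : ℕ) :
    headCoeff m r d j * v ^ d = ∑ q ∈ Finset.HasAntidiagonal.antidiagonal d,
      (r * v / m j) ^ q.1 * (onesSum m r q.2 j * v ^ q.2) := by
  rw [headCoeff, Finset.sum_mul]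
  refine Finset.sum_congr rfl fun q hq => ?_
  rw [← Finset.HasAntidiagonal.mem_antidiagonal.1 hq, pow_add, div_pow, div_pow, mul_pow]
  ring

theorem abs_div_lt_one_of_le {m c : ℝ} (hm : 1 ≤ m) (hc : |c| ≤ 1 / 8) : |c / m| < 1 := by
  rw [abs_div, abs_of_pos (show 0 < m by linarith), div_lt_one (by linarith)]
  linarith

theorem geometric_cauchyProduct (g : ℕ → ℝ) (x : ℝ) (hx : |x| < 1)
    (hg : Summable fun d => ‖g d‖) :
    (Summable fun d =>
      ‖∑ q ∈ Finset.HasAntidiagonal.antidiagonal d, x ^ q.1 * g q.2‖) ∧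
      ∑' d, ∑ q ∈ Finset.HasAntidiagonal.antidiagonal d, x ^ q.1 * g q.2
        = (1 - x)⁻¹ * ∑' d, g d := by
  have hx' : Summable fun l : ℕ => ‖x ^ l‖ := summable_norm_geometric_of_norm_lt_one hx
  refine ⟨summable_norm_sum_mul_antidiagonal_of_summable_norm hx' hg, ?_⟩
  rw [← tsum_geometric_of_norm_lt_one (ξ := x) hx]
  exact (tsum_mul_tsum_eq_tsum_sum_antidiagonal_of_summable_norm hx' hg).symm

theorem headCoeff_generating_aux (m : ℕ → ℝ) (hm : ∀ j, 1 ≤ m j) (r v : ℝ)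
    (h : |r * v| ≤ 1 / 8) (j : ℕ) (S : ℝ)
    (hs : Summable fun d => ‖onesSum m r d j * v ^ d‖)
    (hS : ∑' d, onesSum m r d j * v ^ d = S) :
    (Summable fun d => ‖headCoeff m r d j * v ^ d‖) ∧
      ∑' d, headCoeff m r d j * v ^ d = m j / (m j - r * v) * S := by
  have hc := geometric_cauchyProduct (fun d => onesSum m r d j * v ^ d) (r * v / m j)
    (abs_div_lt_one_of_le (hm j) h) hs
  have h3 : m j ≠ 0 := by linarith [hm j]
  rw [hS, one_sub_div h3, inv_div] at hc
  simpa only [headCoeff_mul_pow] using hc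

theorem onesSum_generating (m : ℕ → ℝ) (hm : ∀ j, 1 ≤ m j) (r v : ℝ)
    (h : |r * v| ≤ 1 / 8) (J : ℕ) :
    (Summable fun d => ‖onesSum m r d J * v ^ d‖) ∧
      ∑' d, onesSum m r d J * v ^ d = ratioProd m r v J := by
  induction J with
  | zero =>
    have h0 : ∀ d, d ≠ 0 → onesSum m r d 0 * v ^ d = 0 := by
      intro d hd
      obtain ⟨d, rfl⟩ := Nat.exists_eq_succ_of_ne_zero hd
      simp [onesSum_succ]
    refine ⟨summable_of_ne_finset_zero (s := {0}) fun d hd => ?_, ?_⟩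
    · rw [h0 d (by simpa using hd), norm_zero]
    · rw [tsum_eq_single 0 h0]
      simp [onesSum_zero, ratioProd]
  | succ J ih =>
    obtain ⟨hs, hS⟩ := ih
    obtain ⟨ht, hT⟩ := headCoeff_generating_aux m hm r v h J _ hs hS
    have hrec : ∀ d, onesSum m r (d + 1) (J + 1) * v ^ (d + 1)
        = onesSum m r (d + 1) J * v ^ (d + 1)
          + v / m J * (headCoeff m r d J * v ^ d) := by
      intro d
      rw [onesSum_succ, onesSum_succ, Finset.sum_range_succ]
      ring
    have hs1 : Summable fun d => onesSum m r (d + 1) J * v ^ (d + 1) :=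
      (summable_nat_add_iff 1).2 hs.of_norm
    have ht1 : Summable fun d => v / m J * (headCoeff m r d J * v ^ d) := ht.of_norm.mul_left _
    have hsum : Summable fun d => onesSum m r d (J + 1) * v ^ d := by
      refine (summable_nat_add_iff 1).1 ?_
      simp only [hrec]
      exact hs1.add ht1
    refine ⟨hsum.norm, ?_⟩
    rw [hsum.tsum_eq_zero_add]
    simp only [hrec]
    rw [hs1.tsum_add ht1, tsum_mul_left, hT, ← add_assoc, onesSum_zero, ← onesSum_zero m r J,
      ← hs.of_norm.tsum_eq_zero_add, hS, ratioProd_succ]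
    have h1 := hm J
    have h2 := (abs_le.1 h).2
    have h3 : m J ≠ 0 := by linarith
    have h4 : m J - r * v ≠ 0 := by linarith
    have h5 : (m J + v * (1 - r)) / (m J - r * v) = 1 + v / (m J - r * v) := by
      rw [one_add_div h4]
      ring
    rw [h5]
    generalize m J - r * v = D at h4 ⊢
    field_simp

theorem headCoeff_generating (m : ℕ → ℝ) (hm : ∀ j, 1 ≤ m j) (r v : ℝ)
    (h : |r * v| ≤ 1 / 8) (j : ℕ) :
    (Summable fun d => ‖headCoeff m r d j * v ^ d‖) ∧
      ∑' d, headCoeff m r d j * v ^ d = m j / (m j - r * v) * ratioProd m r v j :=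
  headCoeff_generating_aux m hm r v h j _ (onesSum_generating m hm r v h j).1
    (onesSum_generating m hm r v h j).2

theorem ratioProd_le_sqrt (m : ℕ → ℝ) (hm : ∀ j : ℕ, (j : ℝ) + 1 ≤ m j) (r v : ℝ) (hv : 0 ≤ v)
    (hv8 : v ≤ 1 / 8) (h : r * v ≤ 1 / 8) (J : ℕ) : ratioProd m r v J ≤ √((J : ℝ) + 1) := by
  induction J with
  | zero => simp [ratioProd]
  | succ J ih =>
    rw [ratioProd_succ]
    have h1 := hm J
    have hJ : (0 : ℝ) ≤ J := J.cast_nonneg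
    have h2 : 0 < m J - r * v := by linarith
    have hle : (m J + v * (1 - r)) / (m J - r * v) ≤ 1 + 1 / (4 * ((J : ℝ) + 1)) := by
      rw [div_le_iff₀ h2]
      have : v ≤ 1 / (4 * ((J : ℝ) + 1)) * (m J - r * v) := by
        rw [div_mul_eq_mul_div, le_div_iff₀ (by positivity)]
        nlinarith
      linarith
    have hpos : 0 ≤ (m J + v * (1 - r)) / (m J - r * v) := div_nonneg (by linarith) h2.le
    calc ratioProd m r v J * ((m J + v * (1 - r)) / (m J - r * v))
        ≤ √((J : ℝ) + 1) * (1 + 1 / (4 * ((J : ℝ) + 1))) :=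
          mul_le_mul ih hle hpos (Real.sqrt_nonneg _)
      _ ≤ √(((J + 1 : ℕ) : ℝ) + 1) := by
          refine Real.le_sqrt_of_sq_le ?_
          rw [mul_pow, Real.sq_sqrt (by positivity)]
          push_cast
          have : 0 < (J : ℝ) + 1 := by positivity
          field_simp
          nlinarith

theorem summable_inv_sq_mul_sqrt :
    Summable fun j : ℕ => (((j : ℝ) + 1) ^ 2)⁻¹ * √((j : ℝ) + 1) := by
  have h := (summable_nat_add_iff 1).2
    (Real.summable_one_div_nat_rpow.2 (by norm_num : (1 : ℝ) < 3 / 2))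
  refine h.congr fun j => ?_
  have hj : (0 : ℝ) < (j : ℝ) + 1 := by positivity
  rw [Nat.cast_add_one, Real.sqrt_eq_rpow, ← Real.rpow_natCast, ← Real.rpow_neg hj.le,
    ← Real.rpow_add hj, one_div, ← Real.rpow_neg hj.le]
  norm_num

theorem summable_inv_sq_mul_truncSum (m : ℕ → ℝ) (hm : ∀ j : ℕ, (j : ℝ) + 1 ≤ m j) (d : ℕ)
    (p : List ℕ) (hp : p ∈ groupings (List.replicate d 1)) :
    Summable fun j => (m j ^ 2)⁻¹ * truncSum m p j := by
  have hm1 : ∀ j, 1 ≤ m j := fun j => le_trans (by simp) (hm j)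
  have hm0 : ∀ j, 0 ≤ m j := fun j => zero_le_one.trans (hm1 j)
  refine Summable.of_nonneg_of_le
    (fun j => mul_nonneg (inv_nonneg.2 (pow_nonneg (hm0 j) _)) (truncSum_nonneg m hm0 p j))
    (fun j => ?_) (summable_inv_sq_mul_sqrt.mul_right (8 ^ d))
  obtain ⟨hs, hS⟩ := onesSum_generating m hm1 1 (1 / 8) (by norm_num) j
  have hnonneg : ∀ d, 0 ≤ onesSum m 1 d j * (1 / 8) ^ d := fun d =>
    mul_nonneg ((abs_nonneg _).trans ((abs_onesSum_le m hm0 1 d j).trans_eq (by simp)))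
      (by positivity)
  have h1 : onesSum m 1 d j * (1 / 8) ^ d ≤ √((j : ℝ) + 1) :=
    (hs.of_norm.le_tsum d fun i _ => hnonneg i).trans (hS.trans_le
      (ratioProd_le_sqrt m hm 1 (1 / 8) (by norm_num) (by norm_num) (by norm_num) j))
  have h2 : truncSum m p j ≤ √((j : ℝ) + 1) * 8 ^ d := by
    refine (truncSum_le_onesSum_one m hm0 d j p hp).trans ?_
    rwa [one_div, inv_pow, ← div_eq_mul_inv, div_le_iff₀ (by positivity)] at h1
  rw [mul_assoc]
  refine mul_le_mul ?_ h2 (truncSum_nonneg m hm0 p j) (by positivity)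
  exact inv_anti₀ (by positivity) (pow_le_pow_left₀ (by positivity) (hm j) 2)

/-- The `j`-th contribution to the coefficient of `u^i v^d` in the generating function. -/
noncomputable def genTerm (m : ℕ → ℝ) (r u v : ℝ) (x : ℕ × ℕ × ℕ) : ℝ :=
  (m x.1 ^ (x.2.1 + 2))⁻¹ * headCoeff m r x.2.2 x.1 * u ^ x.2.1 * v ^ x.2.2

theorem genTerm_fiber (m : ℕ → ℝ) (hm : ∀ j, 1 ≤ m j) (r u v : ℝ) (hu : |u| ≤ 1 / 8)
    (hrv : |r * v| ≤ 1 / 8) (j : ℕ) :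
    (Summable fun q => genTerm m r u v (j, q)) ∧
      ∑' q, genTerm m r u v (j, q)
        = 1 / ((m j - u) * (m j - r * v)) * ratioProd m r v j := by
  have h1 := hm j
  have hu1 := abs_div_lt_one_of_le h1 hu
  obtain ⟨hs, hS⟩ := headCoeff_generating m hm r v hrv j
  have hg : Summable fun i : ℕ => ‖(u / m j) ^ i‖ := summable_norm_geometric_of_norm_lt_one hu1
  have hF : ∀ q : ℕ × ℕ, genTerm m r u v (j, q)
      = (m j ^ 2)⁻¹ * ((u / m j) ^ q.1 * (headCoeff m r q.2 j * v ^ q.2)) := by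
    intro q
    simp only [genTerm]
    rw [div_pow, pow_add, mul_inv]
    ring
  simp only [hF]
  refine ⟨(summable_mul_of_summable_norm hg hs).mul_left _, ?_⟩
  rw [tsum_mul_left, ← tsum_mul_tsum_of_summable_norm hg hs, hS,
    tsum_geometric_of_norm_lt_one (ξ := u / m j) hu1]
  have h3 : m j ≠ 0 := by linarith
  have h4 : m j - r * v ≠ 0 := by linarith [(abs_le.1 hrv).2]
  have h5 : m j - u ≠ 0 := by linarith [(abs_le.1 hu).2]
  rw [one_sub_div h3, inv_div]
  generalize m j - r * v = D at h4 ⊢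
  generalize m j - u = E at h5 ⊢
  field_simp

theorem abs_genTerm_le (m : ℕ → ℝ) (hm : ∀ j, 0 ≤ m j) (r u v : ℝ) (x : ℕ × ℕ × ℕ) :
    |genTerm m r u v x| ≤ genTerm m |r| |u| |v| x := by
  have h := abs_headCoeff_le m hm r x.2.2 x.1
  have h0 : 0 ≤ (m x.1 ^ (x.2.1 + 2))⁻¹ := inv_nonneg.2 (pow_nonneg (hm _) _)
  rw [genTerm, genTerm, abs_mul, abs_mul, abs_mul, abs_pow, abs_pow, abs_of_nonneg h0]
  gcongr

theorem summable_genTerm (m : ℕ → ℝ) (hm : ∀ j : ℕ, (j : ℝ) + 1 ≤ m j) (r u v : ℝ)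
    (hu : |u| ≤ 1 / 8) (hv : |v| ≤ 1 / 8) (hrv : |r * v| ≤ 1 / 8) :
    Summable (genTerm m r u v) := by
  have hm1 : ∀ j, 1 ≤ m j := fun j => le_trans (by simp) (hm j)
  have hm0 : ∀ j, 0 ≤ m j := fun j => zero_le_one.trans (hm1 j)
  have hrv' : |r| * |v| ≤ 1 / 8 := by rwa [← abs_mul]
  have hfib := genTerm_fiber m hm1 |r| |u| |v| (by rwa [abs_abs])
    (by rwa [← abs_mul, abs_abs])
  refine Summable.of_norm_bounded (g := genTerm m |r| |u| |v|) ?_ (abs_genTerm_le m hm0 r u v)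
  refine (summable_prod_of_nonneg
    fun x => (abs_nonneg _).trans (abs_genTerm_le m hm0 r u v x)).2 ⟨fun j => (hfib j).1, ?_⟩
  simp only [fun j => (hfib j).2]
  have hden : ∀ j : ℕ, ((j : ℝ) + 1) ^ 2 / 4 ≤ (m j - |u|) * (m j - |r| * |v|) := by
    intro j
    have hj : (0 : ℝ) ≤ j := j.cast_nonneg
    have h2 : ((j : ℝ) + 1) / 2 ≤ m j - |u| := by linarith [hm j]
    have h3 : ((j : ℝ) + 1) / 2 ≤ m j - |r| * |v| := by linarith [hm j]
    have h := mul_le_mul h2 h3 (by positivity) (by linarith)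
    linarith
  have hprod : ∀ j, 0 ≤ ratioProd m |r| |v| j := by
    intro j
    refine Finset.prod_nonneg fun i _ => div_nonneg ?_ ?_
    · linarith [hm1 i, abs_nonneg v]
    · linarith [hm1 i]
  have hpos : ∀ j : ℕ, 0 < ((j : ℝ) + 1) ^ 2 / 4 := fun j => by positivity
  refine Summable.of_nonneg_of_le
    (fun j => mul_nonneg (one_div_nonneg.2 ((hpos j).le.trans (hden j))) (hprod j))
    (fun j => ?_) (summable_inv_sq_mul_sqrt.mul_left 4)
  have h := mul_le_mul (one_div_le_one_div_of_le (hpos j) (hden j))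
    (ratioProd_le_sqrt m hm |r| |v| (abs_nonneg v) hv hrv' j) (hprod j)
    (one_div_nonneg.2 (hpos j).le)
  refine h.trans_eq ?_
  rw [one_div, inv_div, div_eq_mul_inv, mul_assoc]

theorem poch_mul_add (b : ℝ) (n : ℕ) : poch b n * (b + n) = b * poch (b + 1) n := by
  rw [poch, ← Finset.prod_range_succ fun i : ℕ => b + (i : ℝ), Finset.prod_range_succ', poch]
  push_cast
  rw [add_zero, mul_comm]
  congr 1
  exact Finset.prod_congr rfl fun i _ => by ring

theorem poch_one (n : ℕ) : poch (1 : ℝ) n = n.factorial := by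
  rw [poch, ← Finset.prod_range_add_one_eq_factorial]
  push_cast
  exact Finset.prod_congr rfl fun i _ => add_comm _ _

theorem poch_pos {b : ℝ} (hb : 0 < b) (n : ℕ) : 0 < poch b n :=
  Finset.prod_pos fun i _ => add_pos_of_pos_of_nonneg hb i.cast_nonneg

theorem poch_div_poch_add_one {b : ℝ} (hb : 0 < b) (n : ℕ) :
    poch b n / poch (b + 1) n = b / (b + n) := by
  have h1 : poch (b + 1) n ≠ 0 := (poch_pos (by linarith) n).ne'
  have h2 : b + n ≠ 0 := (add_pos_of_pos_of_nonneg hb n.cast_nonneg).ne'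
  rw [div_eq_div_iff h1 h2, poch_mul_add]

theorem ratioProd_arith (N a : ℕ) (hN : 1 ≤ N) (r v : ℝ) (J : ℕ) :
    ratioProd (fun j => (a : ℝ) + j * N) r v J
      = poch (((a : ℝ) + v * (1 - r)) / N) J / poch (((a : ℝ) - v * r) / N) J := by
  have hN0 : (N : ℝ) ≠ 0 := by positivity
  rw [ratioProd, poch, poch, ← Finset.prod_div_distrib]
  refine Finset.prod_congr rfl fun i _ => ?_
  rw [div_add' _ _ _ hN0, div_add' _ _ _ hN0, div_div_div_cancel_right₀ hN0]
  congr 1 <;> ring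

theorem hypergeometric_term (N a : ℕ) (hN : 1 ≤ N) (r u v : ℝ) (hu : 0 < (a : ℝ) - u)
    (hrv : 0 < (a : ℝ) - v * r) (j : ℕ) :
    1 / (((a : ℝ) + j * N - u) * ((a : ℝ) + j * N - r * v))
        * ratioProd (fun j => (a : ℝ) + j * N) r v j
      = 1 / (((a : ℝ) - u) * ((a : ℝ) - v * r)) *
        ((([((a : ℝ) - u) / N, ((a : ℝ) + v * (1 - r)) / N, 1].map fun x => poch x j).prod /
          ([((a : ℝ) + N - u) / N, ((a : ℝ) + N - v * r) / N].map fun x => poch x j).prod)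
            * 1 ^ j / (j.factorial : ℝ)) := by
  have hN0 : (0 : ℝ) < N := by positivity
  have hj : (0 : ℝ) ≤ j * N := by positivity
  have hb := poch_div_poch_add_one (div_pos hu hN0) j
  have hc := poch_div_poch_add_one (div_pos hrv hN0) j
  have hb1 : ((a : ℝ) + N - u) / N = ((a : ℝ) - u) / N + 1 := by
    field_simp
    ring
  have hc1 : ((a : ℝ) + N - v * r) / N = ((a : ℝ) - v * r) / N + 1 := by
    field_simp
    ring
  have hb2 : ((a : ℝ) - u) / N / (((a : ℝ) - u) / N + j) = ((a : ℝ) - u) / (a + j * N - u) := by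
    rw [div_add' _ _ _ hN0.ne', div_div_div_cancel_right₀ hN0.ne']
    congr 1
    ring
  have hc2 : ((a : ℝ) - v * r) / N / (((a : ℝ) - v * r) / N + j)
      = ((a : ℝ) - v * r) / (a + j * N - r * v) := by
    rw [div_add' _ _ _ hN0.ne', div_div_div_cancel_right₀ hN0.ne']
    congr 1
    ring
  rw [hb2] at hb
  rw [hc2] at hc
  rw [ratioProd_arith N a hN]
  simp only [List.map_cons, List.map_nil, List.prod_cons, List.prod_nil, poch_one, mul_one,
    one_pow, hb1, hc1]
  have hP := (poch_pos (div_pos hrv hN0) j).ne'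
  have hP1 := (poch_pos (b := ((a : ℝ) - v * r) / N + 1) (by positivity) j).ne'
  have hB1 := (poch_pos (b := ((a : ℝ) - u) / N + 1) (by positivity) j).ne'
  have hfac : (j.factorial : ℝ) ≠ 0 := by positivity
  have hD : (a : ℝ) + j * N - u ≠ 0 := by linarith
  have hE : (a : ℝ) + j * N - r * v ≠ 0 := by linarith
  rw [div_eq_div_iff hB1 hD] at hb
  rw [div_eq_div_iff hP1 hE] at hc
  have hu' := hu.ne'
  have hrv' := hrv.ne'
  generalize (a : ℝ) + j * N - u = D at *
  generalize (a : ℝ) + j * N - r * v = E at *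
  generalize poch (((a : ℝ) - u) / N) j = B at *
  generalize poch (((a : ℝ) - u) / N + 1) j = B1 at *
  generalize poch (((a : ℝ) - v * r) / N) j = P at *
  generalize poch (((a : ℝ) - v * r) / N + 1) j = P1 at *
  generalize (a : ℝ) - u = X at *
  generalize (a : ℝ) - v * r = Y at *
  generalize poch (((a : ℝ) + v * (1 - r)) / N) j = Q at *
  field_simp
  linear_combination (-Q * P * E) * hb - Q * X * B1 * hc

theorem add_one_le_arith (N a : ℕ) (hN : 1 ≤ N) (ha1 : 1 ≤ a) (j : ℕ) :
    (j : ℝ) + 1 ≤ (a : ℝ) + j * N := by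
  have h1 : (1 : ℝ) ≤ N := by exact_mod_cast hN
  have h2 : (1 : ℝ) ≤ a := by exact_mod_cast ha1
  linarith [le_mul_of_one_le_right (Nat.cast_nonneg (α := ℝ) j) h1]

theorem hasSum_itv (N a : ℕ) (ha1 : 1 ≤ a) (ha2 : a ≤ N) (r : ℝ) (d x : ℕ) (hx : 2 ≤ x) :
    HasSum (fun j : ℕ => (((a : ℝ) + j * N) ^ x)⁻¹ * headCoeff (fun j => (a : ℝ) + j * N) r d j)
      (itv N a r (x :: List.replicate d 1)) := by
  have hm := add_one_le_arith N a (ha1.trans ha2) ha1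
  have h := hasSum_groupSum_decSum (fun j : ℕ => (a : ℝ) + j * N)
    (fun j => le_trans (by simp) (hm j)) r
    (fun d p hp => summable_inv_sq_mul_truncSum _ hm d p hp) d x hx
  simpa only [itv, tv_eq_decSum N a ha1 ha2, groupSum] using h

/-- The pair `(k, n)` attached to the exponents `(k - n - 1, n - 1)`. -/
def exponentShift (q : ℕ × ℕ) : ℕ × ℕ := (q.1 + q.2 + 2, q.2 + 1)

theorem exponentShift_injective : Function.Injective exponentShift := by
  rintro ⟨i, d⟩ ⟨i', d'⟩ h
  simp only [exponentShift, Prod.mk.injEq] at h ⊢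
  omega

theorem mem_range_exponentShift {p : ℕ × ℕ} (hp : p.2 + 1 ≤ p.1 ∧ 1 ≤ p.2) :
    p ∈ Set.range exponentShift :=
  ⟨(p.1 - p.2 - 1, p.2 - 1), Prod.ext (by simp only [exponentShift]; omega)
    (by simp only [exponentShift]; omega)⟩

/-- Height-one generating function: `Σ_{k ≥ n+1, n ≥ 1} t^r_{N,a}(k-n+1, {1}^{n-1})
u^{k-n-1} v^{n-1}` equals a `₃F₂` evaluated at `1`. -/
theorem stmt3 (N : ℕ) (hN : 1 ≤ N) (a : ℕ) (ha1 : 1 ≤ a) (ha2 : a ≤ N) (r : ℝ) :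
    ∃ ε > (0 : ℝ), ∀ u v : ℝ, |u| < ε → |v| < ε →
      Summable (fun p : ℕ × ℕ =>
        if p.2 + 1 ≤ p.1 ∧ 1 ≤ p.2 then
          itv N a r ((p.1 - p.2 + 1) :: List.replicate (p.2 - 1) 1)
            * u ^ (p.1 - p.2 - 1) * v ^ (p.2 - 1)
        else 0) ∧
      (∑' p : ℕ × ℕ,
        if p.2 + 1 ≤ p.1 ∧ 1 ≤ p.2 then
          itv N a r ((p.1 - p.2 + 1) :: List.replicate (p.2 - 1) 1)
            * u ^ (p.1 - p.2 - 1) * v ^ (p.2 - 1)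
        else 0) =
        1 / (((a : ℝ) - u) * ((a : ℝ) - v * r)) *
          genHyp [((a : ℝ) - u) / N, ((a : ℝ) + v * (1 - r)) / N, 1]
            [((a : ℝ) + N - u) / N, ((a : ℝ) + N - v * r) / N] 1 := by
  refine ⟨1 / (8 * (1 + |r|)), by positivity, fun u v hu hv => ?_⟩
  have hr : 0 ≤ |r| := abs_nonneg r
  have hε : 1 / (8 * (1 + |r|)) ≤ 1 / 8 := one_div_le_one_div_of_le (by norm_num) (by linarith)
  have hu8 : |u| ≤ 1 / 8 := hu.le.trans hε
  have hv8 : |v| ≤ 1 / 8 := hv.le.trans hε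
  have hrv : |r * v| ≤ 1 / 8 := by
    rw [lt_div_iff₀ (by positivity)] at hv
    rw [abs_mul]
    linarith [abs_nonneg v]
  set m : ℕ → ℝ := fun j => (a : ℝ) + j * N with hmdef
  have hm : ∀ j : ℕ, (j : ℝ) + 1 ≤ m j := add_one_le_arith N a hN ha1
  have hm1 : ∀ j, 1 ≤ m j := fun j => le_trans (by simp) (hm j)
  have hF := summable_genTerm m hm r u v hu8 hv8 hrv
  set c : ℕ × ℕ → ℝ := fun p =>
    if p.2 + 1 ≤ p.1 ∧ 1 ≤ p.2 then
      itv N a r ((p.1 - p.2 + 1) :: List.replicate (p.2 - 1) 1)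
        * u ^ (p.1 - p.2 - 1) * v ^ (p.2 - 1)
    else 0 with hc
  have hcq : ∀ q, c (exponentShift q) = ∑' j, genTerm m r u v (j, q) := by
    rintro ⟨i, d⟩
    have hk : i + d + 2 - (d + 1) = i + 1 := by omega
    have hcond : d + 1 + 1 ≤ i + d + 2 ∧ 1 ≤ d + 1 := by omega
    simp only [hc, exponentShift]
    rw [if_pos hcond, hk]
    exact (((hasSum_itv N a ha1 ha2 r d (i + 2) (by omega)).mul_right _).mul_right _).tsum_eq.symm
  have hsupp : ∀ p ∉ Set.range exponentShift, c p = 0 := fun p hp =>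
    if_neg fun h => hp (mem_range_exponentShift h)
  have hG : Summable fun q => ∑' j, genTerm m r u v (j, q) :=
    ((Equiv.prodComm _ _).summable_iff.2 hF).prod
  constructor
  · rw [← exponentShift_injective.summable_iff hsupp]
    exact hG.congr fun q => (hcq q).symm
  · rw [← exponentShift_injective.tsum_eq (f := c) fun p hp => by_contra fun h => hp (hsupp p h)]
    simp only [hcq]
    rw [Summable.tsum_comm (f := fun j q => genTerm m r u v (j, q)) hF, genHyp, ← tsum_mul_left]
    refine tsum_congr fun j => ?_
    rw [(genTerm_fiber m hm1 r u v hu8 hrv j).2]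
    have ha : (1 : ℝ) ≤ a := by exact_mod_cast ha1
    refine hypergeometric_term N a hN r u v ?_ ?_ j
    · linarith [(abs_le.1 hu8).2]
    · linarith [(abs_le.1 hrv).2]
end

section
/- Let N be a positive integer, let a be an integer with 1 ≤ a ≤ N, and let r be a real number. Then there exists ε > 0 such that for all real w with |w| < ε, one has 1 + Σ_{n=1}^∞ t^r_{N,a}({2}ⁿ) wⁿ = exp(Σ_{n=1}^∞ ((rⁿ − (r−1)ⁿ) t_{N,a}(2n)/n) wⁿ), where {2}ⁿ denotes the index (2,2,…,2) with 2 repeated n times and both series converge absolutely. -/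
open Filter Topology

/-- The factor `1/m^k`, restricted to positive `m ≡ a (mod N)`. -/
noncomputable def residueWeight (N a k m : ℕ) : ℝ :=
  if 0 < m ∧ m % N = a % N then ((m : ℝ) ^ k)⁻¹ else 0

/-- The multiple t-value of level `N` truncated to `m₁ < M`. -/
noncomputable def truncTv (N a : ℕ) : ℕ → List ℕ → ℝ
  | _, [] => 1
  | M, k :: ks => ∑ m ∈ Finset.range M, residueWeight N a k m * truncTv N a m ks

/-- The interpolated multiple t-value of level `N` truncated to `m₁ < M`. -/
noncomputable def truncItv (N a : ℕ) (r : ℝ) (M : ℕ) (k : List ℕ) : ℝ :=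
  ((groupings k).map (fun p => r ^ (k.length - p.length) * truncTv N a M p)).sum

section residueWeight

variable (N a : ℕ)

lemma residueWeight_nonneg (k m : ℕ) : 0 ≤ residueWeight N a k m := by
  unfold residueWeight; split_ifs <;> positivity

lemma residueWeight_add (k l m : ℕ) :
    residueWeight N a (k + l) m = residueWeight N a k m * residueWeight N a l m := by
  unfold residueWeight; split_ifs <;> simp [pow_add, mul_comm]

lemma residueWeight_two_mul (n m : ℕ) :
    residueWeight N a (2 * (n + 1)) m = residueWeight N a 2 m ^ (n + 1) := by
  unfold residueWeight; split_ifs <;> simp [pow_mul]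

lemma residueWeight_le {k m : ℕ} (hk : 2 ≤ k) : residueWeight N a k m ≤ ((m : ℝ) ^ 2)⁻¹ := by
  unfold residueWeight
  split_ifs with h
  · have : (1 : ℝ) ≤ m := by exact_mod_cast h.1
    gcongr
  · positivity

lemma residueWeight_le_one (k m : ℕ) : residueWeight N a k m ≤ 1 := by
  unfold residueWeight
  split_ifs with h
  · have : (1 : ℝ) ≤ m := by exact_mod_cast h.1
    exact inv_le_one_of_one_le₀ (one_le_pow₀ this)
  · exact zero_le_one

end residueWeight

lemma exists_sum_inv_sq_le :
    ∃ Z : ℝ, 1 ≤ Z ∧ ∀ M : ℕ, ∑ m ∈ Finset.range M, ((m : ℝ) ^ 2)⁻¹ ≤ Z := by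
  have hs : Summable (fun m : ℕ => ((m : ℝ) ^ 2)⁻¹) :=
    Real.summable_nat_pow_inv.2 one_lt_two
  exact ⟨max 1 (∑' m : ℕ, ((m : ℝ) ^ 2)⁻¹), le_max_left _ _, fun M =>
    (hs.sum_le_tsum _ fun _ _ => by positivity).trans (le_max_right _ _)⟩

section truncTv

variable (N a : ℕ)

lemma truncTv_succ_cons (M k : ℕ) (ks : List ℕ) :
    truncTv N a (M + 1) (k :: ks) =
      truncTv N a M (k :: ks) + residueWeight N a k M * truncTv N a M ks := by
  simp [truncTv, Finset.sum_range_succ]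

lemma truncTv_nonneg (ks : List ℕ) (M : ℕ) : 0 ≤ truncTv N a M ks := by
  induction ks generalizing M with
  | nil => simp [truncTv]
  | cons k ks ih =>
    exact Finset.sum_nonneg fun m _ => mul_nonneg (residueWeight_nonneg ..) (ih m)

lemma truncTv_le {Z : ℝ} (hZ : ∀ M : ℕ, ∑ m ∈ Finset.range M, ((m : ℝ) ^ 2)⁻¹ ≤ Z)
    (ks : List ℕ) (hks : ∀ k ∈ ks, 2 ≤ k) (M : ℕ) : truncTv N a M ks ≤ Z ^ ks.length := by
  have hZ0 : 0 ≤ Z := by simpa using hZ 0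
  induction ks generalizing M with
  | nil => simp [truncTv]
  | cons k ks ih =>
    rw [List.forall_mem_cons] at hks
    calc truncTv N a M (k :: ks)
        ≤ ∑ m ∈ Finset.range M, ((m : ℝ) ^ 2)⁻¹ * Z ^ ks.length :=
          Finset.sum_le_sum fun m _ => mul_le_mul (residueWeight_le N a hks.1) (ih hks.2 m)
            (truncTv_nonneg ..) (by positivity)
      _ ≤ Z ^ (k :: ks).length := by
          rw [← Finset.sum_mul, List.length_cons, pow_succ']
          exact mul_le_mul_of_nonneg_right (hZ M) (by positivity)

open Classical in
/-- The summand of `tv`, extended by zero to all tuples. -/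
noncomputable def tvTerm (k : List ℕ) (f : Fin k.length → ℕ) : ℝ :=
  if StrictAnti f then ∏ i, residueWeight N a (k.get i) (f i) else 0

lemma tvTerm_nonneg (k : List ℕ) (f : Fin k.length → ℕ) : 0 ≤ tvTerm N a k f := by
  unfold tvTerm
  split_ifs
  exacts [Finset.prod_nonneg fun i _ => residueWeight_nonneg .., le_rfl]

lemma tv_eq_tsum_tvTerm (k : List ℕ) : tv N a k = ∑' f, tvTerm N a k f := by
  unfold tv
  rw [← tsum_subtype_eq_of_support_subset
    (s := {f | StrictAnti f ∧ ∀ i, 0 < f i ∧ f i % N = a % N})]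
  · refine tsum_congr fun ⟨f, hf⟩ => ?_
    rw [tvTerm, if_pos hf.1]
    exact Finset.prod_congr rfl fun i _ => by rw [residueWeight, if_pos (hf.2 i)]
  · intro f hf
    unfold tvTerm at hf
    rw [Function.mem_support, ne_eq, ite_eq_right_iff, Classical.not_imp,
      Finset.prod_eq_zero_iff] at hf
    refine ⟨hf.1, fun i => by_contra fun hi => hf.2 ⟨i, Finset.mem_univ _, ?_⟩⟩
    rw [residueWeight, if_neg hi]

lemma strictAnti_cons {n m : ℕ} {f : Fin n → ℕ} :
    StrictAnti (Fin.cons m f : Fin (n + 1) → ℕ) ↔ (∀ i, f i < m) ∧ StrictAnti f := by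
  constructor
  · intro h
    refine ⟨fun i => by simpa using h (Fin.succ_pos i), fun i j hij => ?_⟩
    simpa using h (Fin.succ_lt_succ_iff.2 hij)
  · rintro ⟨h1, h2⟩ i j hij
    cases j using Fin.cases with
    | zero => simp at hij
    | succ j =>
      cases i using Fin.cases with
      | zero => simpa using h1 j
      | succ i => simpa using h2 (Fin.succ_lt_succ_iff.1 hij)

lemma truncTv_eq_sum_tvTerm (k : List ℕ) (M : ℕ) :
    truncTv N a M k = ∑ f ∈ Fintype.piFinset fun _ => Finset.range M, tvTerm N a k f := by
  classical
  induction k generalizing M with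
  | nil =>
    simp [truncTv, tvTerm, Subsingleton.strictAnti]
  | cons k ks ih =>
    simp only [truncTv, ih, Finset.mul_sum]
    rw [Finset.sum_sigma']
    refine Finset.sum_of_injOn (fun x => (Fin.cons x.1 x.2 : Fin (ks.length + 1) → ℕ)) ?_ ?_ ?_ ?_
    · rintro ⟨m, f⟩ _ ⟨m', f'⟩ _ h
      obtain ⟨rfl, rfl⟩ := Fin.cons_inj.1 h
      rfl
    · rintro ⟨m, f⟩ h
      simp only [Finset.coe_sigma, Set.mem_sigma_iff, Finset.mem_coe, Finset.mem_range,
        Fintype.mem_piFinset] at h ⊢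
      intro i
      cases i using Fin.cases with
      | zero => simpa using h.1
      | succ i => simpa using (h.2 i).trans h.1
    · intro f hf hf'
      unfold tvTerm
      refine if_neg fun hanti => hf' ?_
      rw [← Fin.cons_self_tail f, strictAnti_cons] at hanti
      refine ⟨⟨f 0, Fin.tail f⟩, ?_, Fin.cons_self_tail f⟩
      simp only [Finset.coe_sigma, Set.mem_sigma_iff, Finset.mem_coe, Finset.mem_range,
        Fintype.mem_piFinset] at hf ⊢
      exact ⟨hf 0, hanti.1⟩
    · rintro ⟨m, f⟩ h
      simp only [Finset.mem_sigma, Finset.mem_range, Fintype.mem_piFinset] at h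
      simp only [tvTerm, List.length_cons]
      by_cases hf : StrictAnti f
      · rw [if_pos hf, if_pos (strictAnti_cons.2 ⟨h.2, hf⟩), Fin.prod_univ_succ]
        simp
      · rw [if_neg hf, if_neg fun h' => hf (strictAnti_cons.1 h').2, mul_zero]

lemma monotone_piFinset_range (n : ℕ) :
    Monotone fun M : ℕ => Fintype.piFinset fun _ : Fin n => Finset.range M :=
  fun _ _ h => Fintype.piFinset_subset _ _ fun _ => Finset.range_mono h

lemma exists_mem_piFinset_range {n : ℕ} (f : Fin n → ℕ) :
    ∃ M : ℕ, f ∈ Fintype.piFinset fun _ : Fin n => Finset.range M :=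
  ⟨Finset.univ.sup f + 1, by
    simpa [Fintype.mem_piFinset, Nat.lt_succ_iff] using fun i => Finset.le_sup (Finset.mem_univ i)⟩

lemma tendsto_truncTv (k : List ℕ) (hk : ∀ x ∈ k, 2 ≤ x) :
    Tendsto (fun M => truncTv N a M k) atTop (𝓝 (tv N a k)) := by
  obtain ⟨Z, -, hZ⟩ := exists_sum_inv_sq_le
  have hE := tendsto_atTop_finset_of_monotone (monotone_piFinset_range k.length)
    exists_mem_piFinset_range
  have hs : Summable (tvTerm N a k) := by
    refine summable_of_sum_le (c := Z ^ k.length) (tvTerm_nonneg N a k) fun u => ?_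
    obtain ⟨M, hM⟩ := (hE.eventually (eventually_ge_atTop u)).exists
    calc ∑ f ∈ u, tvTerm N a k f ≤ truncTv N a M k := by
          rw [truncTv_eq_sum_tvTerm]
          exact Finset.sum_le_sum_of_subset_of_nonneg hM fun f _ _ => tvTerm_nonneg N a k f
      _ ≤ _ := truncTv_le N a hZ k hk M
  rw [tv_eq_tsum_tvTerm]
  simpa only [truncTv_eq_sum_tvTerm, Function.comp_def] using hs.hasSum.comp hE

end truncTv

section groupings

lemma length_le_of_mem_groupings_s6 {l p : List ℕ} (hp : p ∈ groupings l) :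
    p.length ≤ l.length := by
  induction l using groupings.induct generalizing p with
  | case1 => simp_all [groupings]
  | case2 x => simp_all [groupings]
  | case3 x y l ih₁ ih₂ =>
    rw [groupings, List.mem_append, List.mem_map] at hp
    obtain ⟨q, hq, rfl⟩ | hp := hp
    · simpa using ih₁ hq
    · simpa using (ih₂ hp).trans (Nat.le_succ _)

lemma two_le_of_mem_groupings {l p : List ℕ} (hl : ∀ x ∈ l, 2 ≤ x) (hp : p ∈ groupings l) :
    ∀ x ∈ p, 2 ≤ x := by
  induction l using groupings.induct generalizing p with
  | case1 => simp_all [groupings]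
  | case2 x => simp_all [groupings]
  | case3 x y l ih₁ ih₂ =>
    rw [groupings, List.mem_append, List.mem_map] at hp
    simp only [List.forall_mem_cons] at hl ih₁ ih₂
    obtain ⟨q, hq, rfl⟩ | hp := hp
    · exact List.forall_mem_cons.2 ⟨hl.1, ih₁ hl.2 hq⟩
    · exact ih₂ ⟨by omega, hl.2.2⟩ hp

lemma length_groupings_le (l : List ℕ) : (groupings l).length ≤ 2 ^ l.length := by
  induction l using groupings.induct with
  | case1 => simp [groupings]
  | case2 x => simp [groupings]
  | case3 x y l ih₁ ih₂ =>
    simp only [groupings, List.length_append, List.length_map, List.length_cons] at *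
    rw [pow_succ 2 (l.length + 1)]
    omega

end groupings

lemma abs_list_sum_le_length_mul {L : List ℝ} {c : ℝ} (h : ∀ x ∈ L, |x| ≤ c) :
    |L.sum| ≤ L.length * c := by
  induction L with
  | nil => simp
  | cons x L ih =>
    rw [List.forall_mem_cons] at h
    have := abs_add_le x L.sum
    rw [List.sum_cons, List.length_cons, Nat.cast_succ]
    linarith [ih h.2, h.1]

section truncItv

variable (N a : ℕ) (r : ℝ)

lemma truncItv_nil (M : ℕ) : truncItv N a r M [] = 1 := by
  simp [truncItv, groupings, truncTv]

/-- Merging the first two entries costs a factor `r`; keeping them apart peels off the first. -/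
lemma truncItv_cons_cons (M x y : ℕ) (l : List ℕ) :
    truncItv N a r M (x :: y :: l) =
      ((groupings (y :: l)).map fun p =>
        r ^ ((y :: l).length - p.length) * truncTv N a M (x :: p)).sum +
      r * truncItv N a r M ((x + y) :: l) := by
  unfold truncItv
  rw [groupings, List.map_append, List.sum_append, List.map_map, ← List.sum_map_mul_left]
  congr 2
  · refine List.map_congr_left fun p _ => ?_
    simp
  · refine List.map_congr_left fun p hp => ?_
    have := length_le_of_mem_groupings_s6 hp
    simp only [List.length_cons] at this ⊢
    rw [Nat.succ_sub this, pow_succ]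
    ring

lemma truncItv_zero_cons (x : ℕ) (l : List ℕ) : truncItv N a r 0 (x :: l) = 0 := by
  induction l generalizing x with
  | nil => simp [truncItv, groupings, truncTv]
  | cons y l ih =>
    rw [truncItv_cons_cons, ih]
    simp [truncTv]

lemma abs_truncItv_le {Z : ℝ} (hZ1 : 1 ≤ Z)
    (hZ : ∀ M : ℕ, ∑ m ∈ Finset.range M, ((m : ℝ) ^ 2)⁻¹ ≤ Z)
    (k : List ℕ) (hk : ∀ x ∈ k, 2 ≤ x) (M : ℕ) :
    |truncItv N a r M k| ≤ (2 * ((|r| + 1) * Z)) ^ k.length := by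
  have hr := abs_nonneg r
  have h : |truncItv N a r M k| ≤ (groupings k).length * ((|r| + 1) * Z) ^ k.length := by
    refine (abs_list_sum_le_length_mul (c := ((|r| + 1) * Z) ^ k.length) ?_).trans_eq (by simp)
    simp only [List.mem_map]
    rintro _ ⟨p, hp, rfl⟩
    rw [abs_mul, abs_pow, abs_of_nonneg (truncTv_nonneg N a p M), mul_pow]
    have h1 : |r| ^ (k.length - p.length) ≤ (|r| + 1) ^ k.length :=
      (pow_le_pow_left₀ hr (by linarith) _).trans (pow_le_pow_right₀ (by linarith) (Nat.sub_le _ _))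
    have h2 : truncTv N a M p ≤ Z ^ k.length :=
      (truncTv_le N a hZ p (two_le_of_mem_groupings hk hp) M).trans
        (pow_le_pow_right₀ hZ1 (length_le_of_mem_groupings_s6 hp))
    exact mul_le_mul h1 h2 (truncTv_nonneg ..) (by positivity)
  refine h.trans ?_
  rw [mul_pow 2]
  gcongr
  exact_mod_cast length_groupings_le k

lemma tendsto_truncItv (k : List ℕ) (hk : ∀ x ∈ k, 2 ≤ x) :
    Tendsto (fun M => truncItv N a r M k) atTop (𝓝 (itv N a r k)) :=
  tendsto_list_sum _ fun p hp =>
    (tendsto_truncTv N a p (two_le_of_mem_groupings hk hp)).const_mul _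

lemma truncItv_succ_cons_cons (M x y : ℕ) (l : List ℕ) :
    truncItv N a r (M + 1) (x :: y :: l) - truncItv N a r M (x :: y :: l) =
      residueWeight N a x M * truncItv N a r M (y :: l) +
        r * (truncItv N a r (M + 1) ((x + y) :: l) - truncItv N a r M ((x + y) :: l)) := by
  rw [truncItv_cons_cons, truncItv_cons_cons]
  simp only [truncTv_succ_cons, mul_add, List.sum_map_add]
  have h2 : ((groupings (y :: l)).map fun p => r ^ ((y :: l).length - p.length) *
      (residueWeight N a x M * truncTv N a M p)).sum =
      residueWeight N a x M * truncItv N a r M (y :: l) := by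
    rw [truncItv, ← List.sum_map_mul_left]
    refine congrArg _ (List.map_congr_left fun p _ => ?_)
    exact mul_left_comm _ _ _
  rw [h2]
  ring

lemma truncItv_succ_singleton (M x : ℕ) :
    truncItv N a r (M + 1) [x] - truncItv N a r M [x] = residueWeight N a x M := by
  simp [truncItv, groupings, truncTv, Finset.sum_range_succ]

lemma truncItv_succ_add_cons (M x y : ℕ) (n : ℕ) :
    truncItv N a r (M + 1) ((x + y) :: List.replicate n 2) -
        truncItv N a r M ((x + y) :: List.replicate n 2) =
      residueWeight N a y M * (truncItv N a r (M + 1) (x :: List.replicate n 2) -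
        truncItv N a r M (x :: List.replicate n 2)) := by
  induction n generalizing x with
  | zero =>
    simp only [List.replicate_zero, truncItv_succ_singleton, residueWeight_add]
    ring
  | succ n ih =>
    rw [List.replicate_succ, truncItv_succ_cons_cons, truncItv_succ_cons_cons,
      add_right_comm x y 2, ih, residueWeight_add]
    ring

lemma truncItv_replicate_succ (M n : ℕ) :
    truncItv N a r (M + 1) (List.replicate (n + 1) 2) -
        r * residueWeight N a 2 M * truncItv N a r (M + 1) (List.replicate n 2) =
      truncItv N a r M (List.replicate (n + 1) 2) -
        (r - 1) * residueWeight N a 2 M * truncItv N a r M (List.replicate n 2) := by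
  cases n with
  | zero =>
    have := truncItv_succ_singleton N a r M 2
    simp only [zero_add, List.replicate_one, List.replicate_zero, truncItv_nil]
    linarith
  | succ n =>
    have h1 := truncItv_succ_cons_cons N a r M 2 2 (List.replicate n 2)
    have h2 := truncItv_succ_add_cons N a r M 2 2 n
    rw [h2] at h1
    simp only [← List.replicate_succ] at h1
    linear_combination h1

/-- The generating function of the truncated interpolated values satisfies a one-step recursion. -/
lemma tsum_truncItv_succ (M : ℕ) (w : ℝ)
    (hs : ∀ M, Summable fun n => truncItv N a r M (List.replicate n 2) * w ^ n) :
    (1 - r * residueWeight N a 2 M * w) *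
        ∑' n, truncItv N a r (M + 1) (List.replicate n 2) * w ^ n =
      (1 - (r - 1) * residueWeight N a 2 M * w) *
        ∑' n, truncItv N a r M (List.replicate n 2) * w ^ n := by
  have key (M' : ℕ) (c : ℝ) :
      (1 - c * w) * ∑' n, truncItv N a r M' (List.replicate n 2) * w ^ n =
      1 + ∑' n, (truncItv N a r M' (List.replicate (n + 1) 2) -
        c * truncItv N a r M' (List.replicate n 2)) * w ^ (n + 1) := by
    have h1 := (hs M').tsum_eq_zero_add
    have h2 := ((summable_nat_add_iff 1).2 (hs M')).tsum_sub ((hs M').mul_left (c * w))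
    rw [tsum_mul_left] at h2
    have h3 : ∀ n, (truncItv N a r M' (List.replicate (n + 1) 2) -
        c * truncItv N a r M' (List.replicate n 2)) * w ^ (n + 1) =
        truncItv N a r M' (List.replicate (n + 1) 2) * w ^ (n + 1) -
          c * w * (truncItv N a r M' (List.replicate n 2) * w ^ n) := fun n => by ring
    simp only [h3, h2]
    simp only [List.replicate_zero, truncItv_nil, pow_zero, mul_one] at h1
    linear_combination h1
  rw [key, key]
  simp only [truncItv_replicate_succ]

end truncItv

/-- The logarithm of one Euler-type factor, as a power series. -/
lemma hasSum_log_factor {r x w : ℝ} (h1 : |r * x * w| < 1) (h2 : |(r - 1) * x * w| < 1) :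
    HasSum (fun n : ℕ => (r ^ (n + 1) - (r - 1) ^ (n + 1)) * x ^ (n + 1) / (n + 1 : ℕ) *
      w ^ (n + 1)) (Real.log ((1 - (r - 1) * x * w) / (1 - r * x * w))) := by
  rw [Real.log_div (by linarith [(abs_lt.1 h2).2]) (by linarith [(abs_lt.1 h1).2]),
    ← neg_sub_neg (Real.log (1 - r * x * w))]
  refine ((Real.hasSum_pow_div_log_of_abs_lt_one h1).sub
    (Real.hasSum_pow_div_log_of_abs_lt_one h2)).congr_fun fun n => ?_
  simp only [mul_pow]
  push_cast
  ring

section generatingFunction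

variable (N a : ℕ) (r : ℝ)

lemma truncTv_singleton_succ (M n : ℕ) :
    truncTv N a (M + 1) [2 * (n + 1)] =
      truncTv N a M [2 * (n + 1)] + residueWeight N a 2 M ^ (n + 1) := by
  rw [truncTv_succ_cons, residueWeight_two_mul]
  simp [truncTv]

/-- The truncated generating function is an exponential. -/
lemma tsum_truncItv_eq_exp (w : ℝ) (h1 : |r| * |w| < 1) (h2 : |r - 1| * |w| < 1)
    (hs : ∀ M, Summable fun n => truncItv N a r M (List.replicate n 2) * w ^ n)
    (ht : ∀ M, Summable fun n : ℕ => (r ^ (n + 1) - (r - 1) ^ (n + 1)) *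
      truncTv N a M [2 * (n + 1)] / (n + 1 : ℕ) * w ^ (n + 1)) (M : ℕ) :
    ∑' n, truncItv N a r M (List.replicate n 2) * w ^ n =
      Real.exp (∑' n : ℕ, (r ^ (n + 1) - (r - 1) ^ (n + 1)) *
        truncTv N a M [2 * (n + 1)] / (n + 1 : ℕ) * w ^ (n + 1)) := by
  induction M with
  | zero =>
    rw [(hs 0).tsum_eq_zero_add]
    simp [List.replicate_succ, truncItv_zero_cons, truncItv_nil, truncTv]
  | succ M ih =>
    set x := residueWeight N a 2 M
    have hx0 : 0 ≤ x := residueWeight_nonneg ..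
    have hx1 : x ≤ 1 := residueWeight_le_one ..
    have bound {c : ℝ} (hc : |c| * |w| < 1) : |c * x * w| < 1 := by
      rw [abs_mul, abs_mul, abs_of_nonneg hx0, mul_right_comm]
      exact (mul_le_of_le_one_right (by positivity) hx1).trans_lt hc
    have hp1 : 0 < 1 - r * x * w := by linarith [(abs_lt.1 (bound h1)).2]
    have hp2 : 0 < 1 - (r - 1) * x * w := by linarith [(abs_lt.1 (bound h2)).2]
    have hlog := hasSum_log_factor (bound h1) (bound h2)
    have hsum := ((ht M).hasSum.add hlog).tsum_eq
    have hrw : ∀ n : ℕ, (r ^ (n + 1) - (r - 1) ^ (n + 1)) *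
        truncTv N a (M + 1) [2 * (n + 1)] / (n + 1 : ℕ) * w ^ (n + 1) =
        (r ^ (n + 1) - (r - 1) ^ (n + 1)) * truncTv N a M [2 * (n + 1)] / (n + 1 : ℕ) * w ^ (n + 1)
        + (r ^ (n + 1) - (r - 1) ^ (n + 1)) * x ^ (n + 1) / (n + 1 : ℕ) * w ^ (n + 1) := fun n => by
      rw [truncTv_singleton_succ]
      ring
    simp only [hrw]
    rw [hsum, Real.exp_add, ← ih, Real.exp_log (div_pos hp2 hp1), mul_div_assoc', eq_div_iff hp1.ne',
      mul_comm _ (1 - r * x * w), mul_comm _ (1 - (r - 1) * x * w)]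
    exact tsum_truncItv_succ N a r M w hs

end generatingFunction

lemma hasSum_ite_one_le {f : ℕ → ℝ} (hf : Summable fun n => f (n + 1)) :
    HasSum (fun n => if 1 ≤ n then f n else 0) (∑' n, f (n + 1)) := by
  rw [← hasSum_nat_add_iff' 1]
  simpa using hf.hasSum

/-- Generating function for `t^r_{N,a}({2}ⁿ)`:
`1 + Σ_{n≥1} t^r_{N,a}({2}ⁿ) wⁿ = exp(Σ_{n≥1} (rⁿ - (r-1)ⁿ) t_{N,a}(2n)/n · wⁿ)`. -/
theorem stmt6 (N : ℕ) (hN : 1 ≤ N) (a : ℕ) (ha1 : 1 ≤ a) (ha2 : a ≤ N) (r : ℝ) :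
    ∃ ε > (0 : ℝ), ∀ w : ℝ, |w| < ε →
      Summable (fun n : ℕ =>
        if 1 ≤ n then itv N a r (List.replicate n 2) * w ^ n else 0) ∧
      Summable (fun n : ℕ =>
        if 1 ≤ n then (r ^ n - (r - 1) ^ n) * tv N a [2 * n] / n * w ^ n else 0) ∧
      1 + (∑' n : ℕ,
          if 1 ≤ n then itv N a r (List.replicate n 2) * w ^ n else 0) =
        Real.exp (∑' n : ℕ,
          if 1 ≤ n then (r ^ n - (r - 1) ^ n) * tv N a [2 * n] / n * w ^ n else 0) := by
  obtain ⟨Z, hZ1, hZ⟩ := exists_sum_inv_sq_le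
  have hr := abs_nonneg r
  obtain ⟨K, hK⟩ : ∃ K, K = 2 * ((|r| + 1) * Z) := ⟨_, rfl⟩
  have hrK : |r| + 1 ≤ K := by nlinarith
  have hK0 : 0 < K := by linarith
  refine ⟨K⁻¹, inv_pos.2 hK0, fun w hw => ?_⟩
  have hw0 := abs_nonneg w
  have hKw : K * |w| < 1 := by rwa [← lt_inv_mul_iff₀ hK0, mul_one]
  have hKw0 : 0 ≤ K * |w| := by positivity
  have hr1 : |r - 1| ≤ |r| + 1 := by simpa using abs_sub r 1
  have hgeom := summable_geometric_of_lt_one hKw0 hKw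
  have htwo (n : ℕ) : ∀ x ∈ List.replicate n 2, 2 ≤ x := fun x hx =>
    (List.eq_of_mem_replicate hx).ge
  have hA (M n : ℕ) : ‖truncItv N a r M (List.replicate n 2) * w ^ n‖ ≤ (K * |w|) ^ n := by
    rw [norm_mul, norm_pow, Real.norm_eq_abs, Real.norm_eq_abs, mul_pow]
    have := abs_truncItv_le N a r hZ1 hZ _ (htwo n) M
    rw [List.length_replicate, ← hK] at this
    gcongr
  have hT (M n : ℕ) : ‖(r ^ (n + 1) - (r - 1) ^ (n + 1)) *
      truncTv N a M [2 * (n + 1)] / (n + 1 : ℕ) * w ^ (n + 1)‖ ≤ 2 * Z * (K * |w|) ^ (n + 1) := by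
    have h1 : |r ^ (n + 1) - (r - 1) ^ (n + 1)| ≤ 2 * K ^ (n + 1) := by
      have h2 : |r| ^ (n + 1) ≤ K ^ (n + 1) := pow_le_pow_left₀ hr (by linarith) _
      have h3 : |r - 1| ^ (n + 1) ≤ K ^ (n + 1) :=
        pow_le_pow_left₀ (abs_nonneg _) (by linarith) _
      have h4 := abs_sub (r ^ (n + 1)) ((r - 1) ^ (n + 1))
      rw [abs_pow, abs_pow] at h4
      linarith
    have h5 : |truncTv N a M [2 * (n + 1)]| ≤ Z := by
      rw [abs_of_nonneg (truncTv_nonneg ..)]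
      simpa using truncTv_le N a hZ [2 * (n + 1)] (by simp) M
    have h6 : (1 : ℝ) ≤ (n + 1 : ℕ) := by simp
    rw [norm_mul, norm_div, norm_mul, norm_pow, Real.norm_natCast]
    simp only [Real.norm_eq_abs]
    calc _ ≤ (2 * K ^ (n + 1) * Z) * |w| ^ (n + 1) := by
          gcongr
          exact (div_le_self (by positivity) h6).trans (by gcongr)
      _ = _ := by ring
  have hgeom' : Summable fun n : ℕ => 2 * Z * (K * |w|) ^ (n + 1) :=
    ((summable_nat_add_iff 1).2 hgeom).mul_left _
  have hAlim (n : ℕ) : Tendsto (fun M => truncItv N a r M (List.replicate n 2) * w ^ n) atTop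
      (𝓝 (itv N a r (List.replicate n 2) * w ^ n)) :=
    (tendsto_truncItv N a r _ (htwo n)).mul_const _
  have hTlim (n : ℕ) : Tendsto (fun M => (r ^ (n + 1) - (r - 1) ^ (n + 1)) *
      truncTv N a M [2 * (n + 1)] / (n + 1 : ℕ) * w ^ (n + 1)) atTop
      (𝓝 ((r ^ (n + 1) - (r - 1) ^ (n + 1)) *
        tv N a [2 * (n + 1)] / (n + 1 : ℕ) * w ^ (n + 1))) :=
    (((tendsto_truncTv N a [2 * (n + 1)] (by simp)).const_mul _).div_const _).mul_const _
  have hAsum : Summable fun n => itv N a r (List.replicate n 2) * w ^ n :=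
    .of_norm_bounded hgeom fun n => le_of_tendsto' (hAlim n).norm fun M => hA M n
  have hTsum : Summable fun n : ℕ => (r ^ (n + 1) - (r - 1) ^ (n + 1)) *
      tv N a [2 * (n + 1)] / (n + 1 : ℕ) * w ^ (n + 1) :=
    .of_norm_bounded hgeom' fun n => le_of_tendsto' (hTlim n).norm fun M => hT M n
  have hL := hasSum_ite_one_le (f := fun n => itv N a r (List.replicate n 2) * w ^ n)
    ((summable_nat_add_iff 1).2 hAsum)
  have hR := hasSum_ite_one_le
    (f := fun n : ℕ => (r ^ n - (r - 1) ^ n) * tv N a [2 * n] / n * w ^ n) hTsum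
  refine ⟨hL.summable, hR.summable, ?_⟩
  rw [hL.tsum_eq, hR.tsum_eq]
  have h0 : itv N a r [] = 1 := tendsto_nhds_unique (tendsto_truncItv N a r [] (by simp))
    (by simp only [truncItv_nil, tendsto_const_nhds])
  have hL' := hAsum.tsum_eq_zero_add
  rw [List.replicate_zero, h0, pow_zero, mul_one] at hL'
  rw [← hL']
  refine tendsto_nhds_unique
    (tendsto_tsum_of_dominated_convergence hgeom hAlim (.of_forall fun M n => hA M n)) ?_
  simp only [tsum_truncItv_eq_exp N a r w (by nlinarith) (by nlinarith)
    (fun M => .of_norm_bounded hgeom (hA M)) (fun M => .of_norm_bounded hgeom' (hT M))]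
  exact (Real.continuous_exp.tendsto _).comp
    (tendsto_tsum_of_dominated_convergence hgeom' hTlim (.of_forall fun M n => hT M n))
end
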